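/- If there exists an isomorphism of Hopf algebras φ : U_{r,s}(sl_∞) → U_{v,v^{−1}}(sl_∞) for some v, then r = v and s = v^{−1}. -/

import Mathlib

open scoped TensorProduct

/-! ## The two-parameter quantum group `U_{r,s}(sl_∞)` -/

/-- Generators of `U_{r,s}(sl_∞)`: `e_i, f_i, w_i^{±1}, w'_i^{±1}` for `i ∈ ℕ`. -/
inductive QGen : Type
  | e : ℕ → QGen
  | f : ℕ → QGen
  | w : ℕ → QGen
  | winv : ℕ → QGen
  | w' : ℕ → QGen
  | w'inv : ℕ → QGen

/-- The toral generators `w_i^{±1}, w'_i^{±1}`. -/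
def QGen.toral : QGen → Prop
  | QGen.w _ => True
  | QGen.winv _ => True
  | QGen.w' _ => True
  | QGen.w'inv _ => True
  | _ => False

/-- The bilinear form `⟨i,j⟩` on the root lattice: `⟨i,j⟩ = c_{ij}` for `i < j`,
`⟨i,i⟩ = 1`, and `⟨i,j⟩ = 0` for `i > j`, where `(c_{ij})` is the `A_∞` Cartan matrix. -/
def bform (i j : ℕ) : ℤ := if i = j then 1 else if j = i + 1 then -1 else 0

section QuantumGroup

variable (K : Type) [Field K] (r s : Kˣ)

open FreeAlgebra

/-- The defining relations of `U_{r,s}(sl_∞)`. -/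
inductive QRel : FreeAlgebra K QGen → FreeAlgebra K QGen → Prop
  | tcomm : ∀ a b : QGen, a.toral → b.toral →
      QRel (ι K a * ι K b) (ι K b * ι K a)
  | winv1 : ∀ i, QRel (ι K (QGen.w i) * ι K (QGen.winv i)) 1
  | winv2 : ∀ i, QRel (ι K (QGen.winv i) * ι K (QGen.w i)) 1
  | w'inv1 : ∀ i, QRel (ι K (QGen.w' i) * ι K (QGen.w'inv i)) 1
  | w'inv2 : ∀ i, QRel (ι K (QGen.w'inv i) * ι K (QGen.w' i)) 1
  | we : ∀ i j, QRel (ι K (QGen.w i) * ι K (QGen.e j))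
      ((((r ^ bform j i * s ^ (-bform i j) : Kˣ) : K)) •
        (ι K (QGen.e j) * ι K (QGen.w i)))
  | w'e : ∀ i j, QRel (ι K (QGen.w' i) * ι K (QGen.e j))
      ((((r ^ (-bform i j) * s ^ bform j i : Kˣ) : K)) •
        (ι K (QGen.e j) * ι K (QGen.w' i)))
  | wf : ∀ i j, QRel (ι K (QGen.w i) * ι K (QGen.f j))
      ((((r ^ (-bform j i) * s ^ bform i j : Kˣ) : K)) •
        (ι K (QGen.f j) * ι K (QGen.w i)))
  | w'f : ∀ i j, QRel (ι K (QGen.w' i) * ι K (QGen.f j))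
      ((((r ^ bform i j * s ^ (-bform j i) : Kˣ) : K)) •
        (ι K (QGen.f j) * ι K (QGen.w' i)))
  | ef : ∀ i j, QRel (ι K (QGen.e i) * ι K (QGen.f j))
      (ι K (QGen.f j) * ι K (QGen.e i) +
        if i = j then ((r : K) - (s : K))⁻¹ • (ι K (QGen.w i) - ι K (QGen.w' i)) else 0)
  | ee : ∀ i j, i + 1 < j ∨ j + 1 < i →
      QRel (ι K (QGen.e i) * ι K (QGen.e j)) (ι K (QGen.e j) * ι K (QGen.e i))
  | ff : ∀ i j, i + 1 < j ∨ j + 1 < i →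
      QRel (ι K (QGen.f i) * ι K (QGen.f j)) (ι K (QGen.f j) * ι K (QGen.f i))
  | serre_e1 : ∀ i, QRel
      (ι K (QGen.e i) * ι K (QGen.e i) * ι K (QGen.e (i + 1)) +
        (((r : K) * (s : K))) • (ι K (QGen.e (i + 1)) * ι K (QGen.e i) * ι K (QGen.e i)))
      ((((r : K) + (s : K))) • (ι K (QGen.e i) * ι K (QGen.e (i + 1)) * ι K (QGen.e i)))
  | serre_e2 : ∀ i, QRel
      (ι K (QGen.e i) * ι K (QGen.e (i + 1)) * ι K (QGen.e (i + 1)) +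
        (((r : K) * (s : K))) • (ι K (QGen.e (i + 1)) * ι K (QGen.e (i + 1)) * ι K (QGen.e i)))
      ((((r : K) + (s : K))) • (ι K (QGen.e (i + 1)) * ι K (QGen.e i) * ι K (QGen.e (i + 1))))
  | serre_f1 : ∀ i, QRel
      (ι K (QGen.f i) * ι K (QGen.f i) * ι K (QGen.f (i + 1)) +
        (((r : K) * (s : K))⁻¹) • (ι K (QGen.f (i + 1)) * ι K (QGen.f i) * ι K (QGen.f i)))
      ((((r : K)⁻¹ + (s : K)⁻¹)) • (ι K (QGen.f i) * ι K (QGen.f (i + 1)) * ι K (QGen.f i)))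
  | serre_f2 : ∀ i, QRel
      (ι K (QGen.f i) * ι K (QGen.f (i + 1)) * ι K (QGen.f (i + 1)) +
        (((r : K) * (s : K))⁻¹) • (ι K (QGen.f (i + 1)) * ι K (QGen.f (i + 1)) * ι K (QGen.f i)))
      ((((r : K)⁻¹ + (s : K)⁻¹)) • (ι K (QGen.f (i + 1)) * ι K (QGen.f i) * ι K (QGen.f (i + 1))))

/-- The two-parameter quantum group `U_{r,s}(sl_∞)`. -/
abbrev UQ : Type := RingQuot (QRel K r s)

/-- The generator `e_i` of `U_{r,s}(sl_∞)`. -/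
noncomputable def Ue (i : ℕ) : UQ K r s :=
  RingQuot.mkAlgHom K (QRel K r s) (ι K (QGen.e i))

/-- The generator `f_i` of `U_{r,s}(sl_∞)`. -/
noncomputable def Uf (i : ℕ) : UQ K r s :=
  RingQuot.mkAlgHom K (QRel K r s) (ι K (QGen.f i))

/-- The generator `w_i` of `U_{r,s}(sl_∞)`. -/
noncomputable def Uw (i : ℕ) : UQ K r s :=
  RingQuot.mkAlgHom K (QRel K r s) (ι K (QGen.w i))

/-- The generator `w_i^{-1}` of `U_{r,s}(sl_∞)`. -/
noncomputable def Uwinv (i : ℕ) : UQ K r s :=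
  RingQuot.mkAlgHom K (QRel K r s) (ι K (QGen.winv i))

/-- The generator `w'_i` of `U_{r,s}(sl_∞)`. -/
noncomputable def Uw' (i : ℕ) : UQ K r s :=
  RingQuot.mkAlgHom K (QRel K r s) (ι K (QGen.w' i))

/-- The generator `w'^{-1}_i` of `U_{r,s}(sl_∞)`. -/
noncomputable def Uw'inv (i : ℕ) : UQ K r s :=
  RingQuot.mkAlgHom K (QRel K r s) (ι K (QGen.w'inv i))

end QuantumGroup

section HopfData

variable (K : Type) [CommSemiring K] (A : Type) [Semiring A] [Algebra K A]

/-- Structure maps for a Hopf algebra structure on an algebra `A`: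
a comultiplication, a counit and an antipode. -/
structure HopfData : Type _ where
  comul : A →ₗ[K] A ⊗[K] A
  counit : A →ₗ[K] K
  antipode : A →ₗ[K] A

variable {K A}

/-- The given structure maps make the algebra `A` into a Hopf algebra: the comultiplication
is coassociative and counital, comultiplication and counit are algebra morphisms, and the
antipode axioms hold. -/
def HopfData.IsHopf (D : HopfData K A) : Prop :=
  ((TensorProduct.assoc K A A A).toLinearMap ∘ₗ D.comul.rTensor A ∘ₗ D.comul
      = D.comul.lTensor A ∘ₗ D.comul) ∧
  (D.counit.rTensor A ∘ₗ D.comul = TensorProduct.mk K K A 1) ∧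
  (D.counit.lTensor A ∘ₗ D.comul = (TensorProduct.mk K A K).flip 1) ∧
  (D.comul 1 = 1) ∧ (∀ x y : A, D.comul (x * y) = D.comul x * D.comul y) ∧
  (D.counit 1 = 1) ∧ (∀ x y : A, D.counit (x * y) = D.counit x * D.counit y) ∧
  (LinearMap.mul' K A ∘ₗ D.antipode.rTensor A ∘ₗ D.comul
      = (Algebra.linearMap K A) ∘ₗ D.counit) ∧
  (LinearMap.mul' K A ∘ₗ D.antipode.lTensor A ∘ₗ D.comul
      = (Algebra.linearMap K A) ∘ₗ D.counit)

end HopfData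

/-! ## The field `ℚ(r,s)` -/

/-- The field `ℚ(r,s)` of rational functions in the two parameters `r, s`. -/
abbrev KK : Type := FractionRing (MvPolynomial (Fin 2) ℚ)

/-- The parameter `r`, as a unit of `ℚ(r,s)`. -/
noncomputable def rU : KKˣ :=
  Units.mk0 (algebraMap (MvPolynomial (Fin 2) ℚ) KK (MvPolynomial.X 0)) (by
    simp only [ne_eq, IsFractionRing.to_map_eq_zero_iff]
    exact MvPolynomial.X_ne_zero (0 : Fin 2))

/-- The parameter `s`, as a unit of `ℚ(r,s)`. -/
noncomputable def sU : KKˣ :=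
  Units.mk0 (algebraMap (MvPolynomial (Fin 2) ℚ) KK (MvPolynomial.X 1)) (by
    simp only [ne_eq, IsFractionRing.to_map_eq_zero_iff]
    exact MvPolynomial.X_ne_zero (1 : Fin 2))

set_option synthInstance.maxHeartbeats 1000000
set_option maxHeartbeats 2000000

open scoped TensorProduct

/-- The standard Hopf structure maps on `U_{r,s}(sl_∞)` (for any pair of parameters):
`Δ(e_i) = e_i ⊗ 1 + w_i ⊗ e_i`, `Δ(f_i) = 1 ⊗ f_i + f_i ⊗ w'_i`, the `w_i^{±1}, w'_i^{±1}`
being group-like, with the standard counit. -/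
def StdHopf (K : Type) [Field K] (r s : Kˣ) (D : HopfData K (UQ K r s)) : Prop :=
  D.IsHopf ∧
  (∀ i, D.comul (Uw K r s i) = Uw K r s i ⊗ₜ[K] Uw K r s i) ∧
  (∀ i, D.comul (Uwinv K r s i) = Uwinv K r s i ⊗ₜ[K] Uwinv K r s i) ∧
  (∀ i, D.comul (Uw' K r s i) = Uw' K r s i ⊗ₜ[K] Uw' K r s i) ∧
  (∀ i, D.comul (Uw'inv K r s i) = Uw'inv K r s i ⊗ₜ[K] Uw'inv K r s i) ∧
  (∀ i, D.comul (Ue K r s i) = Ue K r s i ⊗ₜ[K] 1 + Uw K r s i ⊗ₜ[K] Ue K r s i) ∧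
  (∀ i, D.comul (Uf K r s i) = 1 ⊗ₜ[K] Uf K r s i + Uf K r s i ⊗ₜ[K] Uw' K r s i) ∧
  (∀ i, D.counit (Uw K r s i) = 1) ∧ (∀ i, D.counit (Uwinv K r s i) = 1) ∧
  (∀ i, D.counit (Uw' K r s i) = 1) ∧ (∀ i, D.counit (Uw'inv K r s i) = 1) ∧
  (∀ i, D.counit (Ue K r s i) = 0) ∧ (∀ i, D.counit (Uf K r s i) = 0)

/-! ## Generators -/

section Generators

variable {K : Type} [Field K] {r s : Kˣ}

/-- The image in `U_{r,s}(sl_∞)` of a generator. -/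
noncomputable def uqGen (K : Type) [Field K] (r s : Kˣ) (a : QGen) : UQ K r s :=
  RingQuot.mkAlgHom K (QRel K r s) (FreeAlgebra.ι K a)

theorem uq_subalgebra_eq_top (S : Subalgebra K (UQ K r s)) (h : ∀ a, uqGen K r s a ∈ S) :
    S = ⊤ := by
  rw [eq_top_iff]
  intro x _
  obtain ⟨y, rfl⟩ := RingQuot.mkAlgHom_surjective K (QRel K r s) x
  induction y using FreeAlgebra.induction with
  | grade0 c => simp
  | grade1 a => exact h a
  | mul a b ha hb => simpa using S.mul_mem (ha trivial) (hb trivial)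
  | add a b ha hb => simpa using S.add_mem (ha trivial) (hb trivial)

theorem uqGen_toral_comm (a b : QGen) (ha : a.toral) (hb : b.toral) :
    uqGen K r s a * uqGen K r s b = uqGen K r s b * uqGen K r s a := by
  simpa [uqGen] using RingQuot.mkAlgHom_rel K (QRel.tcomm (r := r) (s := s) a b ha hb)

/-- The algebra morphism out of `U_{r,s}(sl_∞)` given by images of the generators. -/
noncomputable def uqLift {B : Type} [Ring B] [Algebra K B] (g : QGen → B)
    (h : ∀ x y, QRel K r s x y → FreeAlgebra.lift K g x = FreeAlgebra.lift K g y) :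
    UQ K r s →ₐ[K] B :=
  RingQuot.liftAlgHom K ⟨FreeAlgebra.lift K g, fun _ _ hxy => h _ _ hxy⟩

theorem uqLift_gen {B : Type} [Ring B] [Algebra K B] (g : QGen → B)
    (h : ∀ x y, QRel K r s x y → FreeAlgebra.lift K g x = FreeAlgebra.lift K g y) (a : QGen) :
    uqLift g h (uqGen K r s a) = g a := by
  simp [uqLift, uqGen, RingQuot.liftAlgHom_mkAlgHom_apply]

/-- In `U_{v,v⁻¹}(sl_∞)` the element `w_i w'_i` is central. -/
theorem commute_w_mul_w' (v : Kˣ) (i : ℕ) (x : UQ K v v⁻¹) :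
    Commute (uqGen K v v⁻¹ (.w i) * uqGen K v v⁻¹ (.w' i)) x := by
  have key : ∀ (p q y : UQ K v v⁻¹) (c d : Kˣ), c * d = 1 → p * y = (c : K) • (y * p) →
      q * y = (d : K) • (y * q) → p * q * y = y * (p * q) := by
    intro p q y c d hcd hp hq
    rw [mul_assoc, hq, mul_smul_comm, ← mul_assoc, hp, smul_mul_assoc, smul_smul, ← Units.val_mul,
      mul_comm d, hcd]
    simp [mul_assoc]
  have hrel : ∀ (a b a' b' : QGen) (c : K),
      QRel K v v⁻¹ (FreeAlgebra.ι K a * FreeAlgebra.ι K b)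
        (c • (FreeAlgebra.ι K a' * FreeAlgebra.ι K b')) →
      uqGen K v v⁻¹ a * uqGen K v v⁻¹ b = c • (uqGen K v v⁻¹ a' * uqGen K v v⁻¹ b') := by
    intro a b a' b' c h
    simpa only [uqGen, map_mul, map_smul] using RingQuot.mkAlgHom_rel K h
  suffices h : Subalgebra.centralizer K {uqGen K v v⁻¹ (.w i) * uqGen K v v⁻¹ (.w' i)} = ⊤ by
    have hx : x ∈ Subalgebra.centralizer K
        {uqGen K v v⁻¹ (.w i) * uqGen K v v⁻¹ (.w' i)} := h ▸ Algebra.mem_top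
    exact (Subalgebra.mem_centralizer_iff K).1 hx _ rfl
  refine uq_subalgebra_eq_top _ fun a => (Subalgebra.mem_centralizer_iff K).2 ?_
  rintro _ rfl
  have ht : ∀ b : QGen, b.toral → uqGen K v v⁻¹ (.w i) * uqGen K v v⁻¹ (.w' i) * uqGen K v v⁻¹ b =
      uqGen K v v⁻¹ b * (uqGen K v v⁻¹ (.w i) * uqGen K v v⁻¹ (.w' i)) := by
    intro b hb
    rw [mul_assoc, uqGen_toral_comm (.w' i) b trivial hb, ← mul_assoc,
      uqGen_toral_comm (.w i) b trivial hb, mul_assoc]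
  cases a with
  | e j =>
    refine key _ _ _ _ _ ?_ (hrel _ _ _ _ _ (QRel.we i j))
      (hrel _ _ _ _ _ (QRel.w'e i j))
    simp only [inv_zpow', ← zpow_add, neg_neg]
    convert zpow_zero v using 2
    ring
  | f j =>
    refine key _ _ _ _ _ ?_ (hrel _ _ _ _ _ (QRel.wf i j))
      (hrel _ _ _ _ _ (QRel.w'f i j))
    simp only [inv_zpow', ← zpow_add, neg_neg]
    convert zpow_zero v using 2
    ring
  | w j => exact ht _ trivial
  | winv j => exact ht _ trivial
  | w' j => exact ht _ trivial
  | w'inv j => exact ht _ trivial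

end Generators

/-! ## Monomials and group-like elements -/

section Filtration

variable {K : Type} [Field K] {r s : Kˣ}

/-- `UQMonomial n x` says that `x` is a product of generators, exactly `n` of which are
among the `e_i, f_i`. -/
inductive UQMonomial (K : Type) [Field K] (r s : Kˣ) : ℕ → UQ K r s → Prop
  | one : UQMonomial K r s 0 1
  | mul_toral {n : ℕ} {x : UQ K r s} (a : QGen) (ha : a.toral) (hx : UQMonomial K r s n x) :
      UQMonomial K r s n (x * uqGen K r s a)
  | mul_root {n : ℕ} {x : UQ K r s} (a : QGen) (ha : ¬ a.toral) (hx : UQMonomial K r s n x) :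
      UQMonomial K r s (n + 1) (x * uqGen K r s a)

/-- The span of the monomials with at most `n` factors among the `e_i, f_i`. -/
noncomputable def uqFiltration (K : Type) [Field K] (r s : Kˣ) (n : ℕ) : Submodule K (UQ K r s) :=
  Submodule.span K {x | ∃ m ≤ n, UQMonomial K r s m x}

theorem uqFiltration_mono : Monotone (uqFiltration K r s) := fun _ _ h =>
  Submodule.span_mono fun _ ⟨m, hm, hx⟩ => ⟨m, hm.trans h, hx⟩

theorem uqMonomial_span_eq_top :
    Submodule.span K {x | ∃ n, UQMonomial K r s n x} = ⊤ := by
  set N := Submodule.span K {x | ∃ n, UQMonomial K r s n x} with hN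
  let S : Subalgebra K (UQ K r s) :=
    { carrier := {x | ∀ y ∈ N, y * x ∈ N}
      mul_mem' := fun {a b} ha hb y hy => by
        rw [← mul_assoc]; exact hb _ (ha _ hy)
      add_mem' := fun {a b} ha hb y hy => by
        rw [mul_add]; exact N.add_mem (ha _ hy) (hb _ hy)
      algebraMap_mem' := fun c y hy => by
        rw [← Algebra.commutes, ← Algebra.smul_def]; exact N.smul_mem _ hy }
  have hS : S = ⊤ := by
    refine uq_subalgebra_eq_top S fun a y hy => ?_
    induction hy using Submodule.span_induction with
    | mem y hy =>
      obtain ⟨n, hn⟩ := hy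
      by_cases ha : a.toral
      · exact Submodule.subset_span ⟨n, hn.mul_toral a ha⟩
      · exact Submodule.subset_span ⟨n + 1, hn.mul_root a ha⟩
    | zero => simp
    | add y z _ _ hy hz => rw [add_mul]; exact N.add_mem hy hz
    | smul c y _ hy => rw [smul_mul_assoc]; exact N.smul_mem _ hy
  rw [eq_top_iff]
  intro x _
  have hx : x ∈ S := hS ▸ Algebra.mem_top
  simpa using hx 1 (Submodule.subset_span ⟨0, .one⟩)

theorem exists_mem_uqFiltration (x : UQ K r s) : ∃ n, x ∈ uqFiltration K r s n := by
  have hx : x ∈ Submodule.span K {x | ∃ n, UQMonomial K r s n x} :=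
    uqMonomial_span_eq_top (K := K) (r := r) (s := s) ▸ Submodule.mem_top
  induction hx using Submodule.span_induction with
  | mem y hy => exact hy.imp fun n hn => Submodule.subset_span ⟨n, le_rfl, hn⟩
  | zero => exact ⟨0, zero_mem _⟩
  | add y z _ _ hy hz =>
    obtain ⟨m, hm⟩ := hy
    obtain ⟨n, hn⟩ := hz
    exact ⟨max m n, add_mem (uqFiltration_mono (le_max_left m n) hm)
      (uqFiltration_mono (le_max_right m n) hn)⟩
  | smul c y _ hy => exact hy.imp fun n hn => Submodule.smul_mem _ _ hn

/-- The span of the tensors of monomials having at most `n` factors among the `e_i, f_i`. -/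
noncomputable def uqTensorFiltration (K : Type) [Field K] (r s : Kˣ) (n : ℕ) :
    Submodule K (UQ K r s ⊗[K] UQ K r s) :=
  Submodule.span K {t | ∃ i j x y, i + j ≤ n ∧ UQMonomial K r s i x ∧ UQMonomial K r s j y ∧
    t = x ⊗ₜ y}

theorem uqTensorFiltration_mono : Monotone (uqTensorFiltration K r s) := fun _ _ h =>
  Submodule.span_mono fun _ ⟨i, j, x, y, hij, hx⟩ => ⟨i, j, x, y, hij.trans h, hx⟩

/-- Right multiplication by an element raising the degree of tensors of monomials by `d`. -/
theorem mul_mem_uqTensorFiltration {n d : ℕ} {t u : UQ K r s ⊗[K] UQ K r s}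
    (ht : t ∈ uqTensorFiltration K r s n)
    (hu : ∀ i j x y, i + j ≤ n → UQMonomial K r s i x → UQMonomial K r s j y →
      (x ⊗ₜ[K] y) * u ∈ uqTensorFiltration K r s (n + d)) :
    t * u ∈ uqTensorFiltration K r s (n + d) := by
  induction ht using Submodule.span_induction with
  | mem t ht =>
    obtain ⟨i, j, x, y, hij, hx, hy, rfl⟩ := ht
    exact hu i j x y hij hx hy
  | zero => simp
  | add y z _ _ hy hz => rw [add_mul]; exact add_mem hy hz
  | smul c y _ hy => rw [smul_mul_assoc]; exact Submodule.smul_mem _ _ hy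

variable {D : HopfData K (UQ K r s)}

theorem StdHopf.comul_toral (hD : StdHopf K r s D) (a : QGen) (ha : a.toral) :
    D.comul (uqGen K r s a) = uqGen K r s a ⊗ₜ uqGen K r s a := by
  obtain ⟨-, h1, h2, h3, h4, -⟩ := hD
  cases a with
  | e j => exact ha.elim
  | f j => exact ha.elim
  | w j => exact h1 j
  | winv j => exact h2 j
  | w' j => exact h3 j
  | w'inv j => exact h4 j

theorem StdHopf.counit_toral (hD : StdHopf K r s D) (a : QGen) (ha : a.toral) :
    D.counit (uqGen K r s a) = 1 := by
  obtain ⟨-, -, -, -, -, -, -, h1, h2, h3, h4, -⟩ := hD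
  cases a with
  | e j => exact ha.elim
  | f j => exact ha.elim
  | w j => exact h1 j
  | winv j => exact h2 j
  | w' j => exact h3 j
  | w'inv j => exact h4 j

theorem StdHopf.comul_one (hD : StdHopf K r s D) : D.comul 1 = 1 := hD.1.2.2.2.1

theorem StdHopf.comul_mul (hD : StdHopf K r s D) (x y : UQ K r s) :
    D.comul (x * y) = D.comul x * D.comul y := hD.1.2.2.2.2.1 x y

theorem StdHopf.counit_one (hD : StdHopf K r s D) : D.counit 1 = 1 := hD.1.2.2.2.2.2.1

theorem StdHopf.counit_mul (hD : StdHopf K r s D) (x y : UQ K r s) :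
    D.counit (x * y) = D.counit x * D.counit y := hD.1.2.2.2.2.2.2.1 x y

theorem StdHopf.comul_monomial (hD : StdHopf K r s D) {n : ℕ} {x : UQ K r s}
    (hx : UQMonomial K r s n x) : D.comul x ∈ uqTensorFiltration K r s n := by
  induction hx with
  | one =>
    rw [hD.comul_one]
    exact Submodule.subset_span ⟨0, 0, 1, 1, le_rfl, .one, .one, rfl⟩
  | @mul_toral n x a ha hx ih =>
    rw [hD.comul_mul, hD.comul_toral a ha]
    refine mul_mem_uqTensorFiltration (d := 0) ih fun i j x y hij hx hy => ?_
    rw [Algebra.TensorProduct.tmul_mul_tmul]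
    exact Submodule.subset_span ⟨i, j, _, _, hij, hx.mul_toral a ha, hy.mul_toral a ha, rfl⟩
  | @mul_root n x a ha hx ih =>
    rw [hD.comul_mul]
    refine mul_mem_uqTensorFiltration ih fun i j x y hij hx hy => ?_
    obtain ⟨-, -, -, -, -, he, hf, -⟩ := hD
    cases a with
    | e k =>
      rw [show D.comul (uqGen K r s (.e k)) = uqGen K r s (.e k) ⊗ₜ[K] 1 +
        uqGen K r s (.w k) ⊗ₜ[K] uqGen K r s (.e k) from he k, mul_add,
        Algebra.TensorProduct.tmul_mul_tmul, Algebra.TensorProduct.tmul_mul_tmul, mul_one]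
      exact add_mem
        (Submodule.subset_span ⟨i + 1, j, _, _, by lia, hx.mul_root _ ha, hy, rfl⟩)
        (Submodule.subset_span
          ⟨i, j + 1, _, _, by lia, hx.mul_toral (.w k) trivial, hy.mul_root _ ha, rfl⟩)
    | f k =>
      rw [show D.comul (uqGen K r s (.f k)) = 1 ⊗ₜ[K] uqGen K r s (.f k) +
        uqGen K r s (.f k) ⊗ₜ[K] uqGen K r s (.w' k) from hf k, mul_add,
        Algebra.TensorProduct.tmul_mul_tmul, Algebra.TensorProduct.tmul_mul_tmul, mul_one]
      exact add_mem
        (Submodule.subset_span ⟨i, j + 1, _, _, by lia, hx, hy.mul_root _ ha, rfl⟩)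
        (Submodule.subset_span
          ⟨i + 1, j, _, _, by lia, hx.mul_root _ ha, hy.mul_toral (.w' k) trivial, rfl⟩)
    | w k => exact (ha trivial).elim
    | winv k => exact (ha trivial).elim
    | w' k => exact (ha trivial).elim
    | w'inv k => exact (ha trivial).elim

theorem StdHopf.comul_mem (hD : StdHopf K r s D) {n : ℕ} {x : UQ K r s}
    (hx : x ∈ uqFiltration K r s n) : D.comul x ∈ uqTensorFiltration K r s n := by
  induction hx using Submodule.span_induction with
  | mem y hy =>
    obtain ⟨m, hm, hy⟩ := hy
    exact uqTensorFiltration_mono hm (hD.comul_monomial hy)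
  | zero => simp
  | add y z _ _ hy hz => rw [map_add]; exact add_mem hy hz
  | smul c y _ hy => rw [map_smul]; exact Submodule.smul_mem _ _ hy

/-- A group-like element lies in the toral part of the filtration. -/
theorem StdHopf.mem_toral_of_comul (hD : StdHopf K r s D) {z : UQ K r s}
    (hz : D.comul z = z ⊗ₜ z) : z ∈ uqFiltration K r s 0 := by
  classical
  have hex := exists_mem_uqFiltration z
  have hmem := Nat.find_spec hex
  have hmin := fun m => Nat.find_min hex (m := m)
  rcases hn : Nat.find hex with _ | n
  · rwa [hn] at hmem
  · rw [hn] at hmem hmin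
    exfalso
    obtain ⟨ξ, hξz, hξ⟩ := Submodule.exists_dual_map_eq_bot_of_notMem (hmin n n.lt_succ_self)
      inferInstance
    have hvanish : ∀ m ≤ n, ∀ x, UQMonomial K r s m x → ξ x = 0 := fun m hm x hx => by
      have h : ξ x ∈ (uqFiltration K r s n).map ξ :=
        Submodule.mem_map_of_mem (Submodule.subset_span ⟨m, hm, hx⟩)
      rwa [hξ, Submodule.mem_bot] at h
    let Ξ : UQ K r s ⊗[K] UQ K r s →ₗ[K] K :=
      LinearMap.mul' K K ∘ₗ TensorProduct.map ξ ξ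
    have hle : uqTensorFiltration K r s (n + 1) ≤ LinearMap.ker Ξ := by
      refine Submodule.span_le.2 ?_
      rintro _ ⟨i, j, x, y, hij, hx, hy, rfl⟩
      change Ξ (x ⊗ₜ y) = 0
      rcases Nat.lt_or_ge n i with h | h
      · simp [Ξ, hvanish j (by lia) y hy]
      · simp [Ξ, hvanish i h x hx]
    have h0 := hle (hD.comul_mem hmem)
    rw [LinearMap.mem_ker, hz] at h0
    simp [Ξ, hξz] at h0

/-- A group-like element is a product of toral generators. -/
theorem StdHopf.monomial_of_groupLike (hD : StdHopf K r s D) {z : UQ K r s}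
    (hz : D.comul z = z ⊗ₜ z) (hz1 : D.counit z = 1) : UQMonomial K r s 0 z := by
  let _ : Coalgebra K (UQ K r s) :=
    { comul := D.comul
      counit := D.counit
      coassoc := hD.1.1
      rTensor_counit_comp_comul := hD.1.2.1
      lTensor_counit_comp_comul := hD.1.2.2.1 }
  have hmono : ∀ n x, UQMonomial K r s n x → n = 0 → IsGroupLikeElem K x := by
    intro n x hx hn
    induction hx with
    | one => exact ⟨hD.counit_one, hD.comul_one⟩
    | @mul_toral n x a ha hx ih =>
      have ih' := ih hn
      have h1 : D.counit x = 1 := ih'.1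
      have h2 : D.comul x = x ⊗ₜ x := ih'.2
      refine ⟨?_, ?_⟩
      · change D.counit _ = 1
        rw [hD.counit_mul, h1, hD.counit_toral a ha, one_mul]
      · change D.comul _ = _
        rw [hD.comul_mul, h2, hD.comul_toral a ha, Algebra.TensorProduct.tmul_mul_tmul]
    | mul_root => exact absurd hn (Nat.succ_ne_zero _)
  by_contra hcon
  have hind : LinearIndepOn K id (insert z {x | UQMonomial K r s 0 x}) :=
    (linearIndepOn_isGroupLikeElem (R := K) (A := UQ K r s)).mono <| by
      rintro x (rfl | hx)
      · exact ⟨hz1, hz⟩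
      · exact hmono 0 x hx rfl
  have hnot := hind.notMem_span_of_insert hcon
  have hmem := hD.mem_toral_of_comul hz
  simp only [uqFiltration, Nat.le_zero, exists_eq_left] at hmem
  simp only [Set.image_id] at hnot
  exact hnot hmem

end Filtration

/-! ## Toral monomials and the vector representation -/

/-- A commuting family of elements of a group extends to the free abelian group. -/
theorem exists_hom_of_commuting {ι G : Type*} [Group G] (g : ι → G)
    (hg : ∀ i j, g i * g j = g j * g i) :
    ∃ F : Multiplicative (ι →₀ ℤ) →* G,
      ∀ i n, F (Multiplicative.ofAdd (Finsupp.single i n)) = g i ^ n := by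
  let C := Subgroup.closure (Set.range g)
  let _ : CommGroup C :=
    { (inferInstance : Group C) with
      mul_comm := (Subgroup.isMulCommutative_closure (k := Set.range g) (by
        rintro _ ⟨i, rfl⟩ _ ⟨j, rfl⟩
        exact hg i j)).is_comm.comm }
  let h : ι → C := fun i => ⟨g i, Subgroup.subset_closure ⟨i, rfl⟩⟩
  let F₀ : (ι →₀ ℤ) →+ Additive C :=
    Finsupp.liftAddHom fun i => zmultiplesHom (Additive C) (Additive.ofMul (h i))
  refine ⟨C.subtype.comp (AddMonoidHom.toMultiplicativeLeft F₀), fun i n => ?_⟩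
  simp [F₀, h]

section VectorRepresentation

variable {K : Type} [Field K] {r s : Kˣ}

/-- The exponent of a toral generator; `Sum.inl i` stands for `w_i`, `Sum.inr i` for `w'_i`. -/
noncomputable def QGen.exponent : QGen → (ℕ ⊕ ℕ →₀ ℤ)
  | .w i => Finsupp.single (Sum.inl i) 1
  | .winv i => Finsupp.single (Sum.inl i) (-1)
  | .w' i => Finsupp.single (Sum.inr i) 1
  | .w'inv i => Finsupp.single (Sum.inr i) (-1)
  | _ => 0

/-- The exponent of `r` in the `k`-th weight of the vector representation. -/
def rWeight (a : ℕ ⊕ ℕ →₀ ℤ) (k : ℕ) : ℤ :=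
  a (Sum.inl k) + if k = 0 then 0 else a (Sum.inr (k - 1))

/-- The exponent of `s` in the `k`-th weight of the vector representation. -/
def sWeight (a : ℕ ⊕ ℕ →₀ ℤ) (k : ℕ) : ℤ :=
  a (Sum.inr k) + if k = 0 then 0 else a (Sum.inl (k - 1))

/-- The `k`-th weight of the vector representation on the toral monomial of exponent `a`. -/
def vecWeight (r s : Kˣ) (a : ℕ ⊕ ℕ →₀ ℤ) (k : ℕ) : K :=
  ((r ^ rWeight a k * s ^ sWeight a k : Kˣ) : K)

theorem vecWeight_zero : vecWeight r s 0 = 1 := by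
  ext k
  simp [vecWeight, rWeight, sWeight]

theorem vecWeight_add (a b : ℕ ⊕ ℕ →₀ ℤ) :
    vecWeight r s (a + b) = vecWeight r s a * vecWeight r s b := by
  ext k
  have h1 : rWeight (a + b) k = rWeight a k + rWeight b k := by
    simp only [rWeight, Finsupp.add_apply]; split_ifs <;> ring
  have h2 : sWeight (a + b) k = sWeight a k + sWeight b k := by
    simp only [sWeight, Finsupp.add_apply]; split_ifs <;> ring
  simp only [vecWeight, h1, h2, zpow_add, Pi.mul_apply, Units.val_mul]
  ring

theorem vecWeight_w (i k : ℕ) : vecWeight r s (QGen.w i).exponent k =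
    if k = i then (r : K) else if k = i + 1 then (s : K) else 1 := by
  rcases k with _ | k
  · simp only [vecWeight, rWeight, sWeight, QGen.exponent, Finsupp.single_apply, Sum.inl.injEq,
      reduceCtorEq, if_false, if_true]
    split_ifs <;> first | (exfalso; lia) | simp
  · simp only [vecWeight, rWeight, sWeight, QGen.exponent, Finsupp.single_apply, Sum.inl.injEq,
      reduceCtorEq, if_false, Nat.add_sub_cancel, Nat.add_eq_zero_iff, and_false]
    split_ifs <;> first | (exfalso; lia) | simp

theorem vecWeight_w' (i k : ℕ) : vecWeight r s (QGen.w' i).exponent k =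
    if k = i then (s : K) else if k = i + 1 then (r : K) else 1 := by
  rcases k with _ | k
  · simp only [vecWeight, rWeight, sWeight, QGen.exponent, Finsupp.single_apply, Sum.inr.injEq,
      reduceCtorEq, if_false, if_true]
    split_ifs <;> first | (exfalso; lia) | simp
  · simp only [vecWeight, rWeight, sWeight, QGen.exponent, Finsupp.single_apply, Sum.inr.injEq,
      reduceCtorEq, if_false, Nat.add_sub_cancel, Nat.add_eq_zero_iff, and_false]
    split_ifs <;> first | (exfalso; lia) | simp

/-- The matrix unit `E_{ij}` acting on sequences. -/
def matUnit (K : Type) [Field K] (i j : ℕ) : Module.End K (ℕ → K) where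
  toFun u k := if k = i then u j else 0
  map_add' u v := by ext k; by_cases h : k = i <;> simp [h]
  map_smul' c u := by ext k; by_cases h : k = i <;> simp [h]

theorem matUnit_apply (i j : ℕ) (u : ℕ → K) (k : ℕ) :
    matUnit K i j u k = if k = i then u j else 0 := rfl

theorem lmul_apply_apply (d u : ℕ → K) (k : ℕ) : Algebra.lmul K (ℕ → K) d u k = d k * u k := rfl

theorem matUnit_mul (i j k l : ℕ) :
    matUnit K i j * matUnit K k l = if j = k then matUnit K i l else 0 := by
  ext u m
  by_cases h : j = k <;> simp [matUnit_apply, h]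

theorem lmul_mul_matUnit (d : ℕ → K) (i j : ℕ) :
    Algebra.lmul K (ℕ → K) d * matUnit K i j = d i • matUnit K i j := by
  ext u m
  by_cases h : m = i <;> simp [matUnit_apply, h]

theorem matUnit_mul_lmul (d : ℕ → K) (i j : ℕ) :
    matUnit K i j * Algebra.lmul K (ℕ → K) d = d j • matUnit K i j := by
  ext u m
  by_cases h : m = i <;> simp [matUnit_apply, h]

/-- The images of the generators in the vector representation. -/
noncomputable def vecGen (r s : Kˣ) : QGen → Module.End K (ℕ → K)
  | .e i => matUnit K i (i + 1)
  | .f i => matUnit K (i + 1) i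
  | a => Algebra.lmul K (ℕ → K) (vecWeight r s a.exponent)

theorem vecGen_toral (a : QGen) (ha : a.toral) :
    vecGen r s a = Algebra.lmul K (ℕ → K) (vecWeight r s a.exponent) := by
  cases a <;> first | rfl | exact ha.elim

theorem vecGen_rel (hne : (r : K) ≠ s) (x y : FreeAlgebra K QGen) (h : QRel K r s x y) :
    FreeAlgebra.lift K (vecGen r s) x = FreeAlgebra.lift K (vecGen r s) y := by
  have hsucc : ∀ i : ℕ, i + 1 + 1 ≠ i := fun i => by lia
  have hsucc_symm : ∀ i : ℕ, i ≠ i + 1 + 1 := fun i => by lia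
  have hinv : ∀ a b : ℕ ⊕ ℕ →₀ ℤ, a + b = 0 →
      Algebra.lmul K (ℕ → K) (vecWeight r s a) * Algebra.lmul K (ℕ → K) (vecWeight r s b) = 1 := by
    intro a b hab
    rw [← map_mul, ← vecWeight_add, hab, vecWeight_zero, map_one]
  induction h with
  | tcomm a b ha hb =>
    simp only [map_mul, FreeAlgebra.lift_ι_apply, vecGen_toral a ha, vecGen_toral b hb]
    rw [← map_mul, ← map_mul, mul_comm]
  | winv1 i =>
    simpa [vecGen] using hinv _ _ (by simp [QGen.exponent])
  | winv2 i =>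
    simpa [vecGen] using hinv _ _ (by simp [QGen.exponent])
  | w'inv1 i =>
    simpa [vecGen] using hinv _ _ (by simp [QGen.exponent])
  | w'inv2 i =>
    simpa [vecGen] using hinv _ _ (by simp [QGen.exponent])
  | we i j =>
    simp only [map_mul, map_smul, FreeAlgebra.lift_ι_apply, vecGen, lmul_mul_matUnit,
      matUnit_mul_lmul, vecWeight_w, smul_smul]
    congr 1
    simp only [bform]
    split_ifs <;> first | (exfalso; lia) | simp
  | w'e i j =>
    simp only [map_mul, map_smul, FreeAlgebra.lift_ι_apply, vecGen, lmul_mul_matUnit,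
      matUnit_mul_lmul, vecWeight_w', smul_smul]
    congr 1
    simp only [bform]
    split_ifs <;> first | (exfalso; lia) | simp [mul_right_comm]
  | wf i j =>
    simp only [map_mul, map_smul, FreeAlgebra.lift_ι_apply, vecGen, lmul_mul_matUnit,
      matUnit_mul_lmul, vecWeight_w, smul_smul]
    congr 1
    simp only [bform]
    split_ifs <;> first | (exfalso; lia) | simp [mul_right_comm]
  | w'f i j =>
    simp only [map_mul, map_smul, FreeAlgebra.lift_ι_apply, vecGen, lmul_mul_matUnit,
      matUnit_mul_lmul, vecWeight_w', smul_smul]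
    congr 1
    simp only [bform]
    split_ifs <;> first | (exfalso; lia) | simp
  | ef i j =>
    by_cases hij : i = j
    · subst hij
      have hsub := sub_ne_zero.2 hne
      simp only [map_mul, map_smul, map_add, map_sub, FreeAlgebra.lift_ι_apply, vecGen, if_true,
        matUnit_mul]
      ext u k
      simp only [matUnit_apply, LinearMap.add_apply, LinearMap.smul_apply, LinearMap.sub_apply,
        Pi.add_apply, Pi.smul_apply, Pi.sub_apply, lmul_apply_apply, vecWeight_w,
        vecWeight_w', smul_eq_mul]
      split_ifs <;> first | lia | (subst_vars; field_simp; try ring)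
    · simp [hij, vecGen, matUnit_mul, Ne.symm hij]
  | ee i j h =>
    simp only [map_mul, FreeAlgebra.lift_ι_apply, vecGen, matUnit_mul]
    split_ifs <;> lia
  | ff i j h =>
    simp only [map_mul, FreeAlgebra.lift_ι_apply, vecGen, matUnit_mul]
    split_ifs <;> lia
  | serre_e1 i => simp [vecGen, matUnit_mul, hsucc]
  | serre_e2 i => simp [vecGen, matUnit_mul, mul_assoc, hsucc]
  | serre_f1 i => simp [vecGen, matUnit_mul, mul_assoc, hsucc_symm]
  | serre_f2 i => simp [vecGen, matUnit_mul, hsucc_symm]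

/-- The vector representation of `U_{r,s}(sl_∞)`. -/
noncomputable def vecRep (hne : (r : K) ≠ s) : UQ K r s →ₐ[K] Module.End K (ℕ → K) :=
  uqLift (vecGen r s) (vecGen_rel hne)

/-- The generators `w_i` and `w'_i` as units. -/
noncomputable def toralUnit (K : Type) [Field K] (r s : Kˣ) : ℕ ⊕ ℕ → (UQ K r s)ˣ
  | .inl i =>
    { val := uqGen K r s (.w i)
      inv := uqGen K r s (.winv i)
      val_inv := by simpa [uqGen] using RingQuot.mkAlgHom_rel K (QRel.winv1 (r := r) (s := s) i)
      inv_val := by simpa [uqGen] using RingQuot.mkAlgHom_rel K (QRel.winv2 (r := r) (s := s) i) }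
  | .inr i =>
    { val := uqGen K r s (.w' i)
      inv := uqGen K r s (.w'inv i)
      val_inv := by simpa [uqGen] using RingQuot.mkAlgHom_rel K (QRel.w'inv1 (r := r) (s := s) i)
      inv_val := by simpa [uqGen] using RingQuot.mkAlgHom_rel K (QRel.w'inv2 (r := r) (s := s) i) }

theorem toralUnit_comm (i j : ℕ ⊕ ℕ) :
    toralUnit K r s i * toralUnit K r s j = toralUnit K r s j * toralUnit K r s i := by
  ext
  rcases i with i | i <;> rcases j with j | j <;> exact uqGen_toral_comm _ _ trivial trivial

/-- If `r` and `s` are multiplicatively independent, a group-like element of `U_{r,s}(sl_∞)`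
commuting with all the `e_i` is trivial. -/
theorem StdHopf.eq_one_of_groupLike_of_commute {D : HopfData K (UQ K r s)}
    (hD : StdHopf K r s D)
    (hrs : ∀ m n : ℤ, (r : K) ^ m * (s : K) ^ n = 1 → m = 0 ∧ n = 0) {z : UQ K r s}
    (hz : D.comul z = z ⊗ₜ z) (hz1 : D.counit z = 1)
    (hcomm : ∀ i, Commute z (uqGen K r s (.e i))) : z = 1 := by
  have hne : (r : K) ≠ s := fun h => by
    have := (hrs 1 (-1) (by simp [h])).1
    lia
  obtain ⟨F, hF⟩ := exists_hom_of_commuting (toralUnit K r s) toralUnit_comm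
  have hgen : ∀ a : QGen, a.toral →
      ((F (Multiplicative.ofAdd a.exponent) : (UQ K r s)ˣ) : UQ K r s) = uqGen K r s a := by
    intro a ha
    cases a <;> first | exact ha.elim | (simp only [QGen.exponent, hF, zpow_one, zpow_neg]; rfl)
  have hword : ∀ n x, UQMonomial K r s n x → n = 0 → ∃ a : ℕ ⊕ ℕ →₀ ℤ,
      ((F (Multiplicative.ofAdd a) : (UQ K r s)ˣ) : UQ K r s) = x ∧
      vecRep hne x = Algebra.lmul K (ℕ → K) (vecWeight r s a) := by
    intro n x hx hn
    induction hx with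
    | one => exact ⟨0, by simp, by rw [vecWeight_zero, map_one, map_one]⟩
    | @mul_toral n x a ha hx ih =>
      obtain ⟨b, rfl, hb⟩ := ih hn
      refine ⟨b + a.exponent, by rw [ofAdd_add, map_mul, Units.val_mul, hgen a ha], ?_⟩
      rw [map_mul, hb, vecWeight_add, map_mul, vecRep, uqLift_gen, vecGen_toral a ha]
    | mul_root => exact absurd hn (Nat.succ_ne_zero _)
  obtain ⟨a, rfl, ha⟩ := hword 0 z (hD.monomial_of_groupLike hz hz1) rfl
  have hstep : ∀ k, vecWeight r s a k = vecWeight r s a (k + 1) := by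
    intro k
    have h := congrArg (vecRep hne) (hcomm k).eq
    rw [map_mul, map_mul, ha, vecRep, uqLift_gen, vecGen, lmul_mul_matUnit,
      matUnit_mul_lmul] at h
    simpa [matUnit_apply] using congrFun (LinearMap.congr_fun h 1) k
  have hconst : ∀ k l, vecWeight r s a k = vecWeight r s a (k + l) := by
    intro k l
    induction l with
    | zero => rfl
    | succ l ih => rw [ih, hstep, add_assoc]
  obtain ⟨N, hN⟩ : ∃ N : ℕ, ∀ k ≥ N, a (.inl k) = 0 ∧ a (.inr k) = 0 := by
    refine ⟨(a.support.sup fun i => Sum.elim id id i) + 1, fun k hk => ⟨?_, ?_⟩⟩ <;>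
    · by_contra h
      have := Finset.le_sup (f := fun i : ℕ ⊕ ℕ => Sum.elim id id i) (Finsupp.mem_support_iff.2 h)
      simp at this
      lia
  have hone : ∀ k, vecWeight r s a k = 1 := by
    intro k
    rw [hconst k (N + 1)]
    simp [vecWeight, rWeight, sWeight, hN (k + N + 1) (by lia), ← add_assoc,
      hN (k + N) (by lia)]
  have hexp : ∀ k, rWeight a k = 0 ∧ sWeight a k = 0 := fun k =>
    hrs _ _ (by simpa [vecWeight] using hone k)
  have hzero : ∀ k, a (.inl k) = 0 ∧ a (.inr k) = 0 := by
    intro k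
    induction k with
    | zero => simpa [rWeight, sWeight] using hexp 0
    | succ k ih => simpa [rWeight, sWeight, ih.1, ih.2] using hexp (k + 1)
  have ha0 : a = 0 := by
    ext i
    rcases i with i | i
    · exact (hzero i).1
    · exact (hzero i).2
  simp [ha0]

end VectorRepresentation

/-- The element `w_0 w'_0` is not trivial: a one-dimensional representation separates it
from `1`. -/
theorem w_mul_w'_ne_one {K : Type} [Field K] [CharZero K] (r s : Kˣ) :
    uqGen K r s (.w 0) * uqGen K r s (.w' 0) ≠ 1 := by
  let g : QGen → K
    | .e _ => 0
    | .f _ => 0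
    | .w _ => 2
    | .winv _ => 2⁻¹
    | .w' _ => 2
    | .w'inv _ => 2⁻¹
  have hg : ∀ x y, QRel K r s x y → FreeAlgebra.lift K g x = FreeAlgebra.lift K g y := by
    intro x y h
    induction h with
    | tcomm a b ha hb => simp [mul_comm]
    | ef i j => by_cases hij : i = j <;> simp [g, hij]
    | _ => simp [g]
  intro h
  have hval := congrArg (uqLift g hg) h
  rw [map_mul, uqLift_gen, uqLift_gen, map_one] at hval
  norm_num [g] at hval

/-- If there is an isomorphism of Hopf algebras
`φ : U_{r,s}(sl_∞) → U_{v,v⁻¹}(sl_∞)` for some `v`, then `r = v` and `s = v⁻¹`. -/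
theorem rigidity_of_parameters (r s v : ℂˣ)
    (hr : Transcendental ℚ (r : ℂ)) (hs : Transcendental ℚ (s : ℂ))
    (hrs : ∀ m n : ℤ, (r : ℂ) ^ m * (s : ℂ) ^ n = 1 → m = 0 ∧ n = 0)
    (D₁ : HopfData ℂ (UQ ℂ r s)) (hD₁ : StdHopf ℂ r s D₁)
    (D₂ : HopfData ℂ (UQ ℂ v v⁻¹)) (hD₂ : StdHopf ℂ v v⁻¹ D₂)
    (φ : UQ ℂ r s ≃ₐ[ℂ] UQ ℂ v v⁻¹)
    (hφcomul : ∀ x, TensorProduct.map φ.toLinearMap φ.toLinearMap (D₁.comul x)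
        = D₂.comul (φ x))
    (hφcounit : ∀ x, D₂.counit (φ x) = D₁.counit x) :
    r = v ∧ s = v⁻¹ := by
  set z := φ.symm (uqGen ℂ v v⁻¹ (.w 0) * uqGen ℂ v v⁻¹ (.w' 0)) with hzdef
  have hφz : φ z = uqGen ℂ v v⁻¹ (.w 0) * uqGen ℂ v v⁻¹ (.w' 0) := φ.apply_symm_apply _
  have hcomul : D₁.comul z = z ⊗ₜ z := by
    apply (TensorProduct.congr φ.toLinearEquiv φ.toLinearEquiv).injective
    change TensorProduct.map φ.toLinearMap φ.toLinearMap (D₁.comul z) = φ z ⊗ₜ φ z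
    rw [hφcomul, hφz, hD₂.comul_mul, hD₂.comul_toral (.w 0) trivial,
      hD₂.comul_toral (.w' 0) trivial,
      Algebra.TensorProduct.tmul_mul_tmul]
  have hcounit : D₁.counit z = 1 := by
    rw [← hφcounit, hφz, hD₂.counit_mul, hD₂.counit_toral (.w 0) trivial,
      hD₂.counit_toral (.w' 0) trivial,
      one_mul]
  have hcomm : ∀ i, Commute z (uqGen ℂ r s (.e i)) := fun i => φ.injective <| by
    rw [map_mul, map_mul, hφz]
    exact commute_w_mul_w' v 0 _
  have hz := hD₁.eq_one_of_groupLike_of_commute hrs hcomul hcounit hcomm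
  rw [hz, map_one] at hφz
  exact absurd hφz.symm (w_mul_w'_ne_one v v⁻¹)
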